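/- Let d ≥ 2 and let Ψ be a translation invariant interaction on Ω = {1,-1}^{Z^d} with |||Ψ|||' < ∞, and let Ψ̃ be its rectangle regrouping. Then Ψ̃ is translation invariant and ‖Ψ̃‖ ≤ |||Ψ|||', i.e. Σ_{0∈Λ⋐Z^d} sup_{ω∈Ω_Λ}|Ψ̃_Λ(ω)| ≤ Σ_{0∈Λ⋐Z^d} |Λ|^{-1}(diam(Λ)+1)^d sup_{ω∈Ω_Λ}|Ψ_Λ(ω)|. -/

import Mathlib

open scoped BigOperators
open Real MeasureTheory Filter Topology

namespace Ising

/-- The lattice `ℤ^d`. -/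
abbrev V (d : ℕ) := Fin d → ℤ
/-- Spin configurations on `ℤ^d`; `true` encodes spin `+1`, `false` encodes spin `-1`. -/
abbrev Config (d : ℕ) := V d → Bool
/-- The ambient euclidean space `ℝ^d`. -/
abbrev Point (d : ℕ) := Fin d → ℝ

variable {d : ℕ}

noncomputable section

/-- The spin value (`±1`) of a boolean. -/
def spin (b : Bool) : ℝ := if b then 1 else -1

/-- An interaction assigns to each finite `Λ ⊆ ℤ^d` a function of configurations
(only the restriction to `Λ` is relevant; see `IsLocal`). -/
abbrev Interaction (d : ℕ) := Finset (V d) → Config d → ℝ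

/-- `Φ_Λ` depends only on the restriction of the configuration to `Λ`. -/
def IsLocal (Φ : Interaction d) : Prop :=
  ∀ (Λ : Finset (V d)) (ω ω' : Config d), (∀ x ∈ Λ, ω x = ω' x) → Φ Λ ω = Φ Λ ω'

/-- Translation of a configuration: `(τ^a ω)(x) = ω(x+a)`. -/
def translate (a : V d) (ω : Config d) : Config d := fun x => ω (x + a)

/-- Translation invariance of an interaction: `Φ_Λ(ω) = Φ_{Λ-a}(τ^a ω)`. -/
def TransInv (Φ : Interaction d) : Prop :=
  ∀ (a : V d) (Λ : Finset (V d)) (ω : Config d),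
    Φ (Λ.image (fun x => x - a)) (translate a ω) = Φ Λ ω

/-- Spin-flip symmetry: `Ψ_Λ(ω) = Ψ_Λ(-ω)`. -/
def SpinFlipSymm (Ψ : Interaction d) : Prop :=
  ∀ (Λ : Finset (V d)) (ω : Config d), Ψ Λ (fun x => !(ω x)) = Ψ Λ ω

/-- `sup_{ω ∈ Ω_Λ} |Φ_Λ(ω)|`. -/
def supNorm (Φ : Interaction d) (Λ : Finset (V d)) : ℝ := ⨆ ω : Config d, |Φ Λ ω|

/-- The summand of the norm `‖Φ‖`. -/
def normTerm (Φ : Interaction d) (Λ : Finset (V d)) : ℝ :=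
  if (0 : V d) ∈ Λ then supNorm Φ Λ else 0

/-- `‖Φ‖ = Σ_{0 ∈ Λ ⋐ ℤ^d} sup_{ω} |Φ_Λ(ω)|`. -/
def anorm (Φ : Interaction d) : ℝ := ∑' Λ : Finset (V d), normTerm Φ Λ

/-- Absolute summability of an interaction. -/
def AbsSummable (Φ : Interaction d) : Prop := Summable (normTerm Φ)

/-- `‖x-y‖_∞`. -/
def distInf (x y : V d) : ℕ := Finset.univ.sup fun i => (x i - y i).natAbs

/-- `‖x-y‖_1`. -/
def dist1 (x y : V d) : ℕ := ∑ i, (x i - y i).natAbs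

/-- `diam(Λ) = sup {‖x-y‖_∞ : x, y ∈ Λ}`. -/
def diam (Λ : Finset (V d)) : ℕ := Λ.sup fun x => Λ.sup fun y => distInf x y

/-- The summand of the `d`-th order decaying norm `|||Ψ|||`. -/
def dTerm (Ψ : Interaction d) (Λ : Finset (V d)) : ℝ :=
  if (0 : V d) ∈ Λ then ((diam Λ + 1 : ℕ) : ℝ) ^ d * supNorm Ψ Λ else 0

/-- `|||Ψ||| = Σ_{0 ∈ Λ ⋐ ℤ^d} (diam(Λ)+1)^d sup_{ω} |Ψ_Λ(ω)|`. -/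
def dnorm (Ψ : Interaction d) : ℝ := ∑' Λ : Finset (V d), dTerm Ψ Λ

/-- Summability of the `d`-th order decaying norm. -/
def DSummable (Ψ : Interaction d) : Prop := Summable (dTerm Ψ)

/-- The summand of the norm `|||Ψ|||'`. -/
def dTerm' (Ψ : Interaction d) (Λ : Finset (V d)) : ℝ :=
  if (0 : V d) ∈ Λ then (Λ.card : ℝ)⁻¹ * ((diam Λ + 1 : ℕ) : ℝ) ^ d * supNorm Ψ Λ else 0

/-- `|||Ψ|||' = Σ_{0 ∈ Λ ⋐ ℤ^d} |Λ|⁻¹ (diam(Λ)+1)^d sup_{ω} |Ψ_Λ(ω)|`. -/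
def dnorm' (Ψ : Interaction d) : ℝ := ∑' Λ : Finset (V d), dTerm' Ψ Λ

/-- Summability of the norm `|||·|||'`. -/
def DSummable' (Ψ : Interaction d) : Prop := Summable (dTerm' Ψ)

/-- The Hamiltonian `H_{Φ,Λ}(ω) = Σ_{Δ ⋐ ℤ^d, Δ ∩ Λ ≠ ∅} Φ_Δ(ω|_Δ)`. -/
def ham (Φ : Interaction d) (Λ : Finset (V d)) (ω : Config d) : ℝ :=
  ∑' Δ : Finset (V d), if (Δ ∩ Λ).Nonempty then Φ Δ ω else 0

/-- The configuration `ω_Λ ∨ η` agreeing with `f` on `Λ` and with `η` off `Λ`. -/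
def fill (Λ : Finset (V d)) (f : ↥Λ → Bool) (η : Config d) : Config d :=
  fun x => if h : x ∈ Λ then f ⟨x, h⟩ else η x

/-- The partition function `Z^η_{Φ,Λ}`. -/
def gibbsZ (Φ : Interaction d) (Λ : Finset (V d)) (η : Config d) : ℝ :=
  ∑ f : ↥Λ → Bool, Real.exp (-(ham Φ Λ (fill Λ f η)))

/-- The finite Gibbs state `μ^η_{Φ,Λ}({ω_Λ})`. -/
def finGibbs (Φ : Interaction d) (Λ : Finset (V d)) (η : Config d) (f : ↥Λ → Bool) : ℝ :=
  Real.exp (-(ham Φ Λ (fill Λ f η))) / gibbsZ Φ Λ η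

/-- The cylinder set `{ξ : ξ|_Λ = f}`. -/
def cyl (Λ : Finset (V d)) (f : ↥Λ → Bool) : Set (Config d) :=
  {ξ | ∀ (x : V d) (h : x ∈ Λ), ξ x = f ⟨x, h⟩}

/-- `σ` is a Gibbs state for `Φ` (DLR condition): for each finite `Λ` there is a Borel
probability measure on boundary conditions with respect to which `σ` of each cylinder
is the average of the finite Gibbs states. -/
def IsGibbs (Φ : Interaction d) (σ : Measure (Config d)) : Prop :=
  IsProbabilityMeasure σ ∧
  ∀ Λ : Finset (V d), ∃ ν : Measure (Config d), IsProbabilityMeasure ν ∧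
    ∀ f : ↥Λ → Bool, (σ (cyl Λ f)).toReal = ∫ η, finGibbs Φ Λ η f ∂ν

/-- Translation invariance of a measure: `τ^a_* σ = σ`. -/
def MeasTransInv (σ : Measure (Config d)) : Prop :=
  ∀ a : V d, σ.map (translate a) = σ

/-- The Ising interaction at inverse temperature `β`:
`Φ^β_Λ(ω) = -β ω(x) ω(y)` if `Λ = {x,y}` with `‖x-y‖₁ = 1`, and `0` otherwise. -/
def ising (β : ℝ) : Interaction d := fun Λ ω =>
  if Λ.card = 2 ∧ ∀ x ∈ Λ, ∀ y ∈ Λ, x ≠ y → dist1 x y = 1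
  then -β * ∏ x ∈ Λ, spin (ω x) else 0

/-- The sum of two interactions. -/
def Iadd (Φ Ψ : Interaction d) : Interaction d := fun Λ ω => Φ Λ ω + Ψ Λ ω

/-- `S` is connected for the adjacency given by `ρ`-distance `1`. -/
def ConnectedBy (ρ : V d → V d → ℕ) (S : Set (V d)) : Prop :=
  ∀ x ∈ S, ∀ y ∈ S, ∃ (n : ℕ) (p : ℕ → V d), p 0 = x ∧ p n = y ∧
    (∀ i ≤ n, p i ∈ S) ∧ ∀ i < n, ρ (p i) (p (i+1)) = 1

/-- `‖·‖₁`-connectedness. -/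
def Conn1 (S : Set (V d)) : Prop := ConnectedBy dist1 S

/-- `‖·‖_∞`-connectedness. -/
def ConnInf (S : Set (V d)) : Prop := ConnectedBy distInf S

/-- A finite set `Λ` is c-connected if both `Λ` and its complement are `‖·‖_∞`-connected. -/
def CConn (Λ : Finset (V d)) : Prop :=
  ConnInf (↑Λ : Set (V d)) ∧ ConnInf ((↑Λ : Set (V d))ᶜ)

/-- `Ψ` vanishes on sets that are not `‖·‖₁`-connected. -/
def ZeroOnNonConn (Ψ : Interaction d) : Prop :=
  ∀ Λ : Finset (V d), ¬ Conn1 (↑Λ : Set (V d)) → ∀ ω, Ψ Λ ω = 0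

/-- The closed unit cube `I_x` centered at `x ∈ ℤ^d`. -/
def cube (x : V d) : Set (Point d) := {y | ∀ i, |y i - (x i : ℝ)| ≤ 1/2}

/-- `M(S) = ⋃_{x ∈ S} I_x`. -/
def cubes (S : Set (V d)) : Set (Point d) := ⋃ x ∈ S, cube x

/-- A contour is the boundary `∂M(S)` of `M(S)` for a finite c-connected `S`. -/
def IsContour (γ : Set (Point d)) : Prop :=
  ∃ S : Finset (V d), CConn S ∧ γ = frontier (cubes ↑S)

/-- The set of sites with spin `-1`. -/
def minusSet (ω : Config d) : Set (V d) := {x | ω x = false}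

/-- `Γ(ω)`: the connected components of `∂M({x : ω(x) = -1})`. -/
def Gamma (ω : Config d) : Set (Set (Point d)) :=
  {γ | ∃ y ∈ frontier (cubes (minusSet ω)),
    γ = connectedComponentIn (frontier (cubes (minusSet ω))) y}

/-- The `(d-1)`-dimensional face of the unit cubes lying between `x` and `x + e_i`. -/
def face (x : V d) (i : Fin d) : Set (Point d) :=
  {y | y i = (x i : ℝ) + 1/2 ∧ ∀ j, j ≠ i → |y j - (x j : ℝ)| ≤ 1/2}

/-- A plaquette is a `(d-1)`-dimensional face of one of the cubes `I_x`. -/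
def IsPlaquette (P : Set (Point d)) : Prop := ∃ x i, P = face x i

/-- `|γ|`: the number of plaquettes contained in `γ`. -/
def csize (γ : Set (Point d)) : ℕ :=
  Nat.card {P : Set (Point d) // IsPlaquette P ∧ P ⊆ γ}

/-- The constant `+1` configuration. -/
def plusC : Config d := fun _ => true

/-- The constant `-1` configuration. -/
def minusC : Config d := fun _ => false

open scoped Classical in
/-- The finite-volume Gibbs probability (with boundary condition `η`) of an event
`A`: `μ^η_{Φ,Λ}({ω : ω ∨ η ∈ A})`. -/
def bcProb (Φ : Interaction d) (Λ : Finset (V d)) (η : Config d) (A : Set (Config d)) : ℝ :=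
  (∑ f : ↥Λ → Bool, if fill Λ f η ∈ A then Real.exp (-(ham Φ Λ (fill Λ f η))) else 0) /
    gibbsZ Φ Λ η

/-- `ω ∈ Ω_Λ^+`, i.e. `ω` is `+1` off `Λ`. -/
def plusOutside (Λ : Finset (V d)) (ω : Config d) : Prop := ∀ x, x ∉ Λ → ω x = true

/-- The configuration obtained by flipping all spins in `S`. -/
def flipOn (S : Finset (V d)) (ω : Config d) : Config d :=
  fun x => if x ∈ S then !(ω x) else ω x

/-- `|𝓔_Λ|`: the number of nearest-neighbour edges meeting `Λ`. -/
def edgeCount (Λ : Finset (V d)) : ℕ :=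
  Nat.card {e : Finset (V d) // (∃ x y, e = {x, y} ∧ dist1 x y = 1) ∧ (e ∩ Λ).Nonempty}

/-- `R` is a (nonempty) rectangle in `ℤ^d`. -/
def IsRect (R : Finset (V d)) : Prop := ∃ a b : V d, a ≤ b ∧ R = Finset.Icc a b

/-- `R(Λ)`: the minimal rectangle containing `Λ`. -/
def minRect (Λ : Finset (V d)) : Finset (V d) :=
  if h : Λ.Nonempty then
    Finset.Icc (fun i => Λ.inf' h fun x => x i) (fun i => Λ.sup' h fun x => x i)
  else ∅

open scoped Classical in
/-- The rectangle regrouping `Ψ̃` of `Ψ`: `Ψ̃_R(ω) = Σ_{Λ : R(Λ) = R} Ψ_Λ(ω|_Λ)` for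
rectangles `R`, and `Ψ̃_Λ = 0` for non-rectangles. -/
def regroup (Ψ : Interaction d) : Interaction d := fun R ω =>
  if IsRect R then ∑ Λ ∈ R.powerset, (if minRect Λ = R then Ψ Λ ω else 0) else 0


/-- Finite sets translated by `-a`, as an equivalence. -/
def shiftE (a : V d) : Finset (V d) ≃ Finset (V d) where
  toFun Λ := Λ.image (fun x => x - a)
  invFun Λ := Λ.image (fun x => x + a)
  left_inv Λ := by simp [Finset.image_image, Function.comp_def]
  right_inv Λ := by
    dsimp only
    rw [Finset.image_image]
    have e : (fun x : V d => x - a) ∘ (fun x => x + a) = id := by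
      funext x
      simp
    rw [e, Finset.image_id]

lemma shiftE_apply (a : V d) (Λ : Finset (V d)) : shiftE a Λ = Λ.image (fun x => x - a) := rfl

lemma mem_shiftE (a : V d) (Λ : Finset (V d)) (y : V d) : y ∈ shiftE a Λ ↔ y + a ∈ Λ := by
  rw [shiftE_apply, Finset.mem_image]
  constructor
  · rintro ⟨x, hx, rfl⟩
    simpa using hx
  · intro h
    exact ⟨y + a, h, by simp⟩

lemma shiftE_Icc (a x y : V d) : shiftE a (Finset.Icc x y) = Finset.Icc (x - a) (y - a) := by
  ext z
  simp [mem_shiftE, Finset.mem_Icc, sub_le_iff_le_add, le_sub_iff_add_le]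

lemma card_shiftE (a : V d) (Λ : Finset (V d)) : (shiftE a Λ).card = Λ.card := by
  rw [shiftE_apply]
  exact Finset.card_image_of_injective _ sub_left_injective

lemma shiftE_nonempty (a : V d) (Λ : Finset (V d)) : (shiftE a Λ).Nonempty ↔ Λ.Nonempty := by
  rw [shiftE_apply, Finset.image_nonempty]

lemma mem_minRect {Λ : Finset (V d)} (z : V d) :
    z ∈ minRect Λ ↔ Λ.Nonempty ∧ ∀ i, (∃ x ∈ Λ, x i ≤ z i) ∧ (∃ x ∈ Λ, z i ≤ x i) := by
  unfold minRect
  split_ifs with h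
  · simp only [Finset.mem_Icc, Pi.le_def, Finset.inf'_le_iff, Finset.le_sup'_iff, h, true_and]
    exact forall_and.symm
  · simp [h]

lemma minRect_shift (a : V d) (Λ : Finset (V d)) :
    minRect (shiftE a Λ) = shiftE a (minRect Λ) := by
  ext z
  rw [mem_shiftE, mem_minRect, mem_minRect, shiftE_nonempty]
  simp [shiftE_apply, le_sub_iff_add_le]

lemma subset_minRect (Λ : Finset (V d)) : Λ ⊆ minRect Λ := by
  intro z hz
  rw [mem_minRect]
  exact ⟨⟨z, hz⟩, fun i => ⟨⟨z, hz, le_rfl⟩, ⟨z, hz, le_rfl⟩⟩⟩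

lemma isRect_shift (a : V d) (R : Finset (V d)) : IsRect (shiftE a R) ↔ IsRect R := by
  constructor
  · rintro ⟨x, y, h, e⟩
    refine ⟨x + a, y + a, by simpa using h, ?_⟩
    apply (shiftE a).injective
    rw [e, shiftE_Icc]; simp
  · rintro ⟨x, y, h, rfl⟩
    exact ⟨x - a, y - a, by simpa using h, shiftE_Icc _ _ _⟩

lemma regroup_transInv (Ψ : Interaction d) (hti : TransInv Ψ) : TransInv (regroup Ψ) := by
  intro a R ω
  change regroup Ψ (shiftE a R) (translate a ω) = _
  unfold regroup
  by_cases h : IsRect R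
  · rw [if_pos h, if_pos ((isRect_shift a R).2 h)]
    symm
    apply Finset.sum_equiv (shiftE a)
    · intro Λ
      simp only [Finset.mem_powerset, shiftE_apply]
      exact (Finset.image_subset_image_iff sub_left_injective).symm
    · intro Λ _
      have e : Ψ (shiftE a Λ) (translate a ω) = Ψ Λ ω := hti a Λ ω
      rw [e]
      exact if_congr (by rw [minRect_shift, (shiftE a).injective.eq_iff]) rfl rfl
  · rw [if_neg h, if_neg (fun h' => h ((isRect_shift a R).1 h'))]

lemma bdd_local (Ψ : Interaction d) (hloc : IsLocal Ψ) (Λ : Finset (V d)) :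
    BddAbove (Set.range fun ω : Config d => |Ψ Λ ω|) := by
  apply Set.Finite.bddAbove
  apply (Set.finite_range (fun f : ↥Λ → Bool => |Ψ Λ (fill Λ f plusC)|)).subset
  rintro _ ⟨ω, rfl⟩
  refine ⟨fun x => ω x, ?_⟩
  dsimp only
  congr 1
  apply hloc
  intro x hx
  simp [fill, hx]

lemma supNorm_nonneg (Ψ : Interaction d) (Λ : Finset (V d)) : 0 ≤ supNorm Ψ Λ :=
  Real.iSup_nonneg fun _ => abs_nonneg _

lemma supNorm_shift (Ψ : Interaction d) (hti : TransInv Ψ) (a : V d) (Λ : Finset (V d)) :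
    supNorm Ψ (shiftE a Λ) = supNorm Ψ Λ := by
  unfold supNorm
  have hs : Function.Surjective (translate a : Config d → Config d) := by
    intro ω
    refine ⟨translate (-a) ω, ?_⟩
    funext x
    simp [translate]
  rw [← hs.iSup_comp]
  simp only [shiftE_apply, hti a Λ]

open scoped Classical in
lemma supNorm_regroup_le (Ψ : Interaction d) (hloc : IsLocal Ψ) (R : Finset (V d)) :
    supNorm (regroup Ψ) R ≤
      ∑ Λ ∈ R.powerset, (if minRect Λ = R then supNorm Ψ Λ else 0) := by
  have hnn : 0 ≤ ∑ Λ ∈ R.powerset, (if minRect Λ = R then supNorm Ψ Λ else 0) :=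
    Finset.sum_nonneg fun Λ _ => by split_ifs <;> simp [supNorm_nonneg]
  apply ciSup_le
  intro ω
  unfold regroup
  split_ifs with h
  · refine (Finset.abs_sum_le_sum_abs _ _).trans (Finset.sum_le_sum fun Λ _ => ?_)
    split_ifs
    · exact le_ciSup (bdd_local Ψ hloc Λ) ω
    · simp
  · simpa using hnn

lemma natAbs_le_diam {Λ : Finset (V d)} {x y : V d} (hx : x ∈ Λ) (hy : y ∈ Λ) (i : Fin d) :
    (x i - y i).natAbs ≤ diam Λ :=
  calc (x i - y i).natAbs ≤ distInf x y :=
        Finset.le_sup (f := fun i => (x i - y i).natAbs) (Finset.mem_univ i)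
    _ ≤ Λ.sup (fun y => distInf x y) := Finset.le_sup (f := fun y => distInf x y) hy
    _ ≤ diam Λ := Finset.le_sup (f := fun x => Λ.sup fun y => distInf x y) hx

lemma card_minRect_le (Λ : Finset (V d)) : (minRect Λ).card ≤ (diam Λ + 1) ^ d := by
  unfold minRect
  split_ifs with h
  · rw [Pi.card_Icc]
    refine (Finset.prod_le_pow_card _ _ (diam Λ + 1) ?_).trans (by simp)
    intro i _
    obtain ⟨x, hx, ex⟩ := Finset.exists_mem_eq_inf' h (fun x : V d => x i)
    obtain ⟨y, hy, ey⟩ := Finset.exists_mem_eq_sup' h (fun x : V d => x i)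
    rw [ex, ey, Int.card_Icc]
    have := natAbs_le_diam hy hx i
    omega
  · simp

open scoped ENNReal

/-- The sup norm with values in `ℝ≥0∞`. -/
def sE (Ψ : Interaction d) (Λ : Finset (V d)) : ℝ≥0∞ := ENNReal.ofReal (supNorm Ψ Λ)

open scoped Classical in
lemma tsum_regroup_le (Ψ : Interaction d) (hloc : IsLocal Ψ) :
    ∑' R, ENNReal.ofReal (normTerm (regroup Ψ) R) ≤
      ∑' Λ : Finset (V d), if (0 : V d) ∈ minRect Λ then sE Ψ Λ else 0 := by
  have key : ∀ R, ENNReal.ofReal (normTerm (regroup Ψ) R) ≤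
      ∑' Λ : Finset (V d), if (0 : V d) ∈ R ∧ minRect Λ = R then sE Ψ Λ else 0 := by
    intro R
    unfold normTerm
    split_ifs with h0
    · refine (ENNReal.ofReal_le_ofReal (supNorm_regroup_le Ψ hloc R)).trans ?_
      rw [ENNReal.ofReal_sum_of_nonneg
        (fun Λ _ => by split_ifs <;> simp [supNorm_nonneg])]
      refine le_trans (le_of_eq ?_) (ENNReal.sum_le_tsum R.powerset)
      refine Finset.sum_congr rfl fun Λ _ => ?_
      by_cases h : minRect Λ = R <;> simp [h, h0, sE]
    · simp
  refine (ENNReal.tsum_le_tsum key).trans ?_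
  rw [ENNReal.tsum_comm]
  refine ENNReal.tsum_le_tsum fun Λ => ?_
  rw [tsum_eq_single (minRect Λ)]
  · simp
  · intro R hR
    simp [hR.symm]

open scoped Classical in
lemma mass_transport (Ψ : Interaction d) (hti : TransInv Ψ) :
    (∑' Λ : Finset (V d), if (0 : V d) ∈ minRect Λ then sE Ψ Λ else 0) =
      ∑' Λ : Finset (V d), if (0 : V d) ∈ Λ then
        ((minRect Λ).card : ℝ≥0∞) * ((Λ.card : ℝ≥0∞)⁻¹ * sE Ψ Λ) else 0 := by
  have h1 : ∀ Λ : Finset (V d), (if (0 : V d) ∈ minRect Λ then sE Ψ Λ else 0) =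
      ∑' x : V d, if x ∈ Λ ∧ (0 : V d) ∈ minRect Λ then (Λ.card : ℝ≥0∞)⁻¹ * sE Ψ Λ else 0 := by
    intro Λ
    by_cases h : (0 : V d) ∈ minRect Λ
    · have hne : Λ.Nonempty := ((mem_minRect _).1 h).1
      rw [tsum_eq_sum (s := Λ) (fun x hx => by simp [hx])]
      rw [Finset.sum_congr rfl (g := fun _ => (Λ.card : ℝ≥0∞)⁻¹ * sE Ψ Λ)
        (fun x hx => by simp [hx, h])]
      rw [Finset.sum_const, nsmul_eq_mul, ← mul_assoc, ENNReal.mul_inv_cancel, one_mul]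
      · simp [h]
      · simpa using hne.ne_empty
      · simp
    · simp [h]
  simp_rw [h1]
  rw [ENNReal.tsum_comm]
  have h2 : ∀ x : V d, (∑' Λ : Finset (V d), if x ∈ Λ ∧ (0 : V d) ∈ minRect Λ then
        (Λ.card : ℝ≥0∞)⁻¹ * sE Ψ Λ else 0) =
      ∑' Λ : Finset (V d), if (0 : V d) ∈ Λ ∧ -x ∈ minRect Λ then
        (Λ.card : ℝ≥0∞)⁻¹ * sE Ψ Λ else 0 := by
    intro x
    rw [← (shiftE (-x)).tsum_eq]
    refine tsum_congr fun Λ => ?_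
    simp [minRect_shift, mem_shiftE, card_shiftE, sE, supNorm_shift Ψ hti]
  simp_rw [h2]
  rw [ENNReal.tsum_comm]
  refine tsum_congr fun Λ => ?_
  by_cases h : (0 : V d) ∈ Λ
  · rw [← (Equiv.neg (V d)).tsum_eq]
    simp only [h, true_and, Equiv.neg_apply, neg_neg, if_true]
    rw [tsum_eq_sum (s := minRect Λ) (fun x hx => by simp [hx])]
    rw [Finset.sum_congr rfl (g := fun _ => (Λ.card : ℝ≥0∞)⁻¹ * sE Ψ Λ)
        (fun x hx => by simp [hx])]
    rw [Finset.sum_const, nsmul_eq_mul]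
  · simp [h]

lemma dTerm'_nonneg (Ψ : Interaction d) (Λ : Finset (V d)) : 0 ≤ dTerm' Ψ Λ := by
  unfold dTerm'
  have := supNorm_nonneg Ψ Λ
  split_ifs <;> positivity

lemma normTerm_nonneg (Ψ : Interaction d) (Λ : Finset (V d)) : 0 ≤ normTerm Ψ Λ := by
  unfold normTerm
  have := supNorm_nonneg Ψ Λ
  split_ifs <;> positivity

lemma tsum_main (Ψ : Interaction d) (hloc : IsLocal Ψ) (hti : TransInv Ψ) :
    ∑' R, ENNReal.ofReal (normTerm (regroup Ψ) R) ≤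
      ∑' Λ, ENNReal.ofReal (dTerm' Ψ Λ) := by
  refine (tsum_regroup_le Ψ hloc).trans ?_
  rw [mass_transport Ψ hti]
  refine ENNReal.tsum_le_tsum fun Λ => ?_
  unfold dTerm'
  split_ifs with h
  · have hc : (0 : ℝ) < Λ.card := by exact_mod_cast Finset.card_pos.2 ⟨0, h⟩
    rw [mul_comm ((Λ.card : ℝ)⁻¹), mul_assoc, ENNReal.ofReal_mul (by positivity),
      ENNReal.ofReal_mul (by positivity), ENNReal.ofReal_inv_of_pos hc, ENNReal.ofReal_natCast,
      ← Nat.cast_pow, ENNReal.ofReal_natCast]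
    unfold sE
    gcongr
    exact card_minRect_le Λ
  · simp

/-- the rectangle regrouping `Ψ̃` of a translation invariant `Ψ` with
`|||Ψ|||' < ∞` is translation invariant and satisfies `‖Ψ̃‖ ≤ |||Ψ|||'`. -/
theorem regroup_trans_inv_and_norm (d : ℕ) (hd : 2 ≤ d)
    (Ψ : Interaction d) (hloc : IsLocal Ψ) (hti : TransInv Ψ) (hsum : DSummable' Ψ) :
    TransInv (regroup Ψ) ∧ AbsSummable (regroup Ψ) ∧ anorm (regroup Ψ) ≤ dnorm' Ψ := by
  have hm := tsum_main Ψ hloc hti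
  rw [← ENNReal.ofReal_tsum_of_nonneg (dTerm'_nonneg Ψ) hsum] at hm
  have hs : Summable (normTerm (regroup Ψ)) := by
    have h := ENNReal.summable_toReal (ne_top_of_le_ne_top ENNReal.ofReal_ne_top hm)
    simpa only [ENNReal.toReal_ofReal (normTerm_nonneg _ _)] using h
  refine ⟨regroup_transInv Ψ hti, hs, ?_⟩
  rw [← ENNReal.ofReal_tsum_of_nonneg (normTerm_nonneg _) hs] at hm
  exact (ENNReal.ofReal_le_ofReal_iff (tsum_nonneg (dTerm'_nonneg Ψ))).1 hm

end
end Ising
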